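/- Every potential on a recurrent rooted network is 1-Lipschitz with respect to the effective resistance metric: |h(x)−h(y)| ≤ R_eff(x↔y) for all x,y∈V. -/

import Mathlib

open scoped Classical
open Filter Topology MeasureTheory ProbabilityTheory

/-- A weighted network: an infinite, connected, locally finite graph with
positive edge conductances, encoded by a symmetric conductance function. -/
structure Network (V : Type*) where
  c : V → V → ℝ
  symm : ∀ x y, c x y = c y x
  nonneg : ∀ x y, 0 ≤ c x y
  locFin : ∀ x, {y | 0 < c x y}.Finite
  conn : ∀ x y, Relation.ReflTransGen (fun a b => 0 < c a b) x y
  deg_pos : ∀ x, 0 < ∑' y, c x y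
  infinite : Infinite V

namespace Network

variable {V : Type*} (N : Network V)

/-- Total conductance at a vertex. -/
noncomputable def cTot (x : V) : ℝ := ∑' y, N.c x y

/-- One-step transition probabilities of the network random walk. -/
noncomputable def p (x y : V) : ℝ := N.c x y / N.cTot x

/-- `n`-step transition probabilities of the network random walk. -/
noncomputable def pstep : ℕ → V → V → ℝ
  | 0, x, y => if x = y then 1 else 0
  | n + 1, x, y => ∑' z, pstep n x z * N.p z y

/-- The network random walk is recurrent: the expected number of returns is infinite. -/
def Recurrent : Prop := ∀ x : V, ¬ Summable (fun n => N.pstep n x x)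

/-- `avoid A n x y` is the probability that the walk started at `x` is at `y` at time `n`
without having visited the set `A` at any time `0,…,n`, i.e. `P_x(X_n = y, τ_A > n)`. -/
noncomputable def avoid (A : Set V) : ℕ → V → V → ℝ
  | 0, x, y => if x = y ∧ x ∉ A then 1 else 0
  | n + 1, x, y => if y ∈ A then 0 else ∑' z, avoid A n x z * N.p z y

/-- Green kernel of the walk killed at `o`:  `G_o(x,y) = Σ_n P_x(X_n = y, τ_o > n)`. -/
noncomputable def GreenK (o x y : V) : ℝ := ∑' n, N.avoid {o} n x y

/-- Green density of the walk killed at `o`:  `g_o(x,y) = G_o(x,y)/c_y`. -/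
noncomputable def g (o x y : V) : ℝ := N.GreenK o x y / N.cTot y

/-- The network Laplacian `Δf(v) = Σ_x c_{vx}(f(x) − f(v))`. -/
noncomputable def lap (f : V → ℝ) (v : V) : ℝ := ∑' x, N.c v x * (f x - f v)

/-- A potential on the rooted network `(G,c,o)`: a nonnegative function vanishing at `o`,
with Laplacian `1` at `o` and harmonic elsewhere. -/
def IsPotential (o : V) (h : V → ℝ) : Prop :=
  (∀ v, 0 ≤ h v) ∧ h o = 0 ∧ N.lap h o = 1 ∧ ∀ v, v ≠ o → N.lap h v = 0

/-- Harmonic measure from `v` on a set `A`:  `ω_v^A(z) = P_v(X_{τ_A} = z)`. -/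
noncomputable def harm (A : Set V) (v z : V) : ℝ :=
  if v ∈ A then (if v = z then 1 else 0)
  else if z ∈ A then ∑' n, ∑' w, N.avoid A n v w * N.p w z
  else 0

/-- Effective resistance `R_eff(x ↔ y) = g_x(y,y)`. -/
noncomputable def Reff (x y : V) : ℝ := N.g x y y

/-- Transition probabilities of the Doob `h`-transform: `p^h(x,y) = p(x,y) h(y)/h(x)`. -/
noncomputable def ph (h : V → ℝ) (x y : V) : ℝ := N.p x y * h y / h x

/-- `n`-step transition probabilities of the `h`-process. -/
noncomputable def phstep (h : V → ℝ) : ℕ → V → V → ℝ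
  | 0, x, y => if x = y then 1 else 0
  | n + 1, x, y => ∑' z, phstep h n x z * N.ph h z y

/-- The initial distribution `μ_h(v) = c_{ov} h(v)`. -/
noncomputable def muh (o : V) (h : V → ℝ) (v : V) : ℝ := N.c o v * h v

end Network

/-- `P` is the law of the Markov chain with initial distribution `μ` and transition
probabilities `q`, as a measure on trajectory space. -/
def IsChainLaw {S : Type*} [MeasurableSpace S] (μ : S → ℝ) (q : S → S → ℝ)
    (P : MeasureTheory.Measure (ℕ → S)) : Prop :=
  ∀ (n : ℕ) (v : ℕ → S),
    P {ω | ∀ i ≤ n, ω i = v i} =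
      ENNReal.ofReal (μ (v 0) * ∏ i ∈ Finset.range n, q (v i) (v (i + 1)))

namespace Network

variable {V : Type*} (N : Network V)

/-- Neighbours. -/
noncomputable def nb (v : V) : Finset V := (N.locFin v).toFinset

/-- Markov operator. -/
noncomputable def PP (φ : V → ℝ) (v : V) : ℝ := ∑ z ∈ N.nb v, N.p v z * φ z

/-- Kill a function on `A`. -/
noncomputable def kill (A : Set V) (φ : V → ℝ) (z : V) : ℝ := if z ∈ A then 0 else φ z

/-- Expectation under the killed walk. -/
noncomputable def EE (A : Set V) (n : ℕ) (y : V) (φ : V → ℝ) : ℝ :=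
  ∑' v, N.avoid A n y v * φ v

lemma kill_empty (φ : V → ℝ) : kill ∅ φ = φ := by
  funext z; simp [kill]

lemma cTot_pos (v : V) : 0 < N.cTot v := N.deg_pos v

lemma c_zero {v z : V} (hz : z ∉ N.nb v) : N.c v z = 0 := by
  have h1 : ¬ 0 < N.c v z := by simpa [nb] using hz
  exact le_antisymm (not_lt.mp h1) (N.nonneg v z)

lemma p_zero {v z : V} (hz : z ∉ N.nb v) : N.p v z = 0 := by
  simp [p, N.c_zero hz]

lemma p_zero' {v z : V} (hz : z ∉ N.nb v) : N.p z v = 0 := by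
  simp [p, N.symm z v, N.c_zero hz]

lemma p_nonneg (v z : V) : 0 ≤ N.p v z := div_nonneg (N.nonneg v z) (N.cTot_pos v).le

lemma p_pos {v z : V} (h : 0 < N.c v z) : 0 < N.p v z := div_pos h (N.cTot_pos v)

lemma p_symm (v z : V) : N.p z v / N.cTot v = N.p v z / N.cTot z := by
  have := (N.cTot_pos v).ne'
  have := (N.cTot_pos z).ne'
  simp only [p, N.symm z v]
  field_simp

lemma cTot_eq (v : V) : N.cTot v = ∑ z ∈ N.nb v, N.c v z :=
  tsum_eq_sum (fun _ hz => N.c_zero hz)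

lemma PP_tsum (φ : V → ℝ) (v : V) : ∑' z, N.p v z * φ z = N.PP φ v :=
  tsum_eq_sum (fun z hz => by simp [N.p_zero hz])

lemma sum_p (v : V) : ∑ z ∈ N.nb v, N.p v z = 1 := by
  simp only [p, ← Finset.sum_div, ← N.cTot_eq]
  exact div_self (N.cTot_pos v).ne'

lemma PP_const (a : ℝ) (v : V) : N.PP (fun _ => a) v = a := by
  simp [PP, ← Finset.sum_mul, N.sum_p]

lemma PP_mono {φ ψ : V → ℝ} (h : ∀ z, φ z ≤ ψ z) (v : V) : N.PP φ v ≤ N.PP ψ v :=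
  Finset.sum_le_sum fun z _ => mul_le_mul_of_nonneg_left (h z) (N.p_nonneg v z)

lemma PP_nonneg {φ : V → ℝ} (h : ∀ z, 0 ≤ φ z) (v : V) : 0 ≤ N.PP φ v :=
  Finset.sum_nonneg fun z _ => mul_nonneg (N.p_nonneg v z) (h z)

lemma PP_sub (φ ψ : V → ℝ) (v : V) : N.PP (fun z => φ z - ψ z) v = N.PP φ v - N.PP ψ v := by
  simp [PP, mul_sub]

lemma PP_kill (x : V) (φ : V → ℝ) (v : V) :
    N.PP (kill {x} φ) v = N.PP φ v - N.p v x * φ x := by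
  have h1 : N.p v x * φ x = N.PP (fun z => if z = x then φ z else 0) v := by
    simp only [PP, mul_ite, mul_zero, Finset.sum_ite_eq']
    split_ifs with hx
    · rfl
    · simp [N.p_zero hx]
  rw [h1, ← PP_sub]
  congr 1
  funext z
  by_cases hz : z = x <;> simp [kill, hz]

lemma PP_tendsto {φ : ℕ → V → ℝ} {ψ : V → ℝ}
    (h : ∀ z, Tendsto (fun n => φ n z) atTop (𝓝 (ψ z))) (v : V) :
    Tendsto (fun n => N.PP (φ n) v) atTop (𝓝 (N.PP ψ v)) :=
  tendsto_finsetSum _ fun z _ => (h z).const_mul _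

lemma PP_lap (h : V → ℝ) (v : V) : N.PP h v = h v + N.lap h v / N.cTot v := by
  have h1 : N.lap h v = ∑ z ∈ N.nb v, N.c v z * (h z - h v) :=
    tsum_eq_sum (fun z hz => by simp [N.c_zero hz])
  have h2 : N.lap h v / N.cTot v = N.PP (fun z => h z - h v) v := by
    rw [h1, Finset.sum_div, PP]
    refine Finset.sum_congr rfl fun z _ => ?_
    simp only [p]; ring
  rw [h2, PP_sub, PP_const]; ring

lemma avoid_supp (A : Set V) (y : V) (n : ℕ) :
    ∃ S : Finset V, ∀ v, v ∉ S → N.avoid A n y v = 0 := by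
  induction n with
  | zero =>
    refine ⟨{y}, fun v hv => ?_⟩
    have : y ≠ v := fun h => hv (by simp [h])
    simp [avoid, this]
  | succ n ih =>
    obtain ⟨S, hS⟩ := ih
    refine ⟨S.biUnion N.nb, fun v hv => ?_⟩
    have : ∀ z, N.avoid A n y z * N.p z v = 0 := by
      intro z
      by_cases hz : z ∈ S
      · have : v ∉ N.nb z := fun h => hv (Finset.mem_biUnion.mpr ⟨z, hz, h⟩)
        simp [N.p_zero this]
      · simp [hS z hz]
    simp [avoid, this]

lemma avoid_nonneg (A : Set V) (y : V) (n : ℕ) (v : V) : 0 ≤ N.avoid A n y v := by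
  induction n generalizing v with
  | zero => simp only [avoid]; split_ifs <;> norm_num
  | succ n ih =>
    simp only [avoid]
    split_ifs
    · exact le_rfl
    · exact tsum_nonneg fun z => mul_nonneg (ih z) (N.p_nonneg z v)

lemma avoid_mem (A : Set V) (y : V) (n : ℕ) {v : V} (hv : v ∈ A) : N.avoid A n y v = 0 := by
  cases n with
  | zero =>
    simp only [avoid]
    rw [if_neg]
    rintro ⟨rfl, h⟩
    exact h hv
  | succ n => simp [avoid, hv]

lemma avoid_start (A : Set V) {y : V} (hy : y ∈ A) (n : ℕ) (v : V) : N.avoid A n y v = 0 := by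
  induction n generalizing v with
  | zero => simp [avoid, hy]
  | succ n ih => simp [avoid, ih]

lemma avoid_succ (A : Set V) (y : V) (n : ℕ) {v : V} (hv : v ∉ A) :
    N.avoid A (n+1) y v = ∑ z ∈ N.nb v, N.avoid A n y z * N.p z v := by
  simp only [avoid, if_neg hv]
  exact tsum_eq_sum (fun z hz => by simp [N.p_zero' hz])

lemma EE_summable (A : Set V) (n : ℕ) (y : V) (φ : V → ℝ) :
    Summable (fun v => N.avoid A n y v * φ v) := by
  obtain ⟨S, hS⟩ := N.avoid_supp A y n
  exact summable_of_ne_finset_zero (s := S) (fun v hv => by simp [hS v hv])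

lemma EE_mono (A : Set V) (n : ℕ) (y : V) {φ ψ : V → ℝ} (h : ∀ z, φ z ≤ ψ z) :
    N.EE A n y φ ≤ N.EE A n y ψ :=
  (N.EE_summable A n y φ).tsum_le_tsum
    (fun z => mul_le_mul_of_nonneg_left (h z) (N.avoid_nonneg A y n z)) (N.EE_summable A n y ψ)

lemma EE_nonneg (A : Set V) (n : ℕ) (y : V) {φ : V → ℝ} (h : ∀ z, 0 ≤ φ z) :
    0 ≤ N.EE A n y φ :=
  tsum_nonneg fun z => mul_nonneg (N.avoid_nonneg A y n z) (h z)

lemma EE_add (A : Set V) (n : ℕ) (y : V) (φ ψ : V → ℝ) :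
    N.EE A n y (fun z => φ z + ψ z) = N.EE A n y φ + N.EE A n y ψ := by
  simp only [EE, mul_add]
  exact (N.EE_summable A n y φ).tsum_add (N.EE_summable A n y ψ)

lemma EE_sub (A : Set V) (n : ℕ) (y : V) (φ ψ : V → ℝ) :
    N.EE A n y (fun z => φ z - ψ z) = N.EE A n y φ - N.EE A n y ψ := by
  simp only [EE, mul_sub]
  exact (N.EE_summable A n y φ).tsum_sub (N.EE_summable A n y ψ)

lemma EE_mul (A : Set V) (n : ℕ) (y : V) (φ : V → ℝ) (a : ℝ) :
    N.EE A n y (fun z => φ z * a) = N.EE A n y φ * a := by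
  simp only [EE, ← mul_assoc]
  exact tsum_mul_right

lemma EE_single (A : Set V) (n : ℕ) (y o : V) (a : ℝ) :
    N.EE A n y (fun z => if z = o then a else 0) = N.avoid A n y o * a := by
  simp only [EE, mul_ite, mul_zero]
  rw [tsum_eq_single o]
  · simp
  · intro b hb; simp [hb]

lemma EE_zero (A : Set V) (y : V) (hy : y ∉ A) (φ : V → ℝ) : N.EE A 0 y φ = φ y := by
  simp only [EE, avoid]
  rw [tsum_eq_single y]
  · simp [hy]
  · intro b hb; simp [hb.symm]

lemma EE_succ (A : Set V) (n : ℕ) (y : V) (φ : V → ℝ) :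
    N.EE A (n+1) y φ = N.EE A n y (N.PP (kill A φ)) := by
  obtain ⟨S, hS⟩ := N.avoid_supp A y n
  set ψ : V → ℝ := kill A φ with hψ
  have h1 : ∀ v, N.avoid A (n+1) y v * φ v
      = ∑ z ∈ S, N.avoid A n y z * (N.p z v * ψ v) := by
    intro v
    by_cases hv : v ∈ A
    · simp [hψ, hv, avoid, kill]
    · simp only [avoid, hψ, kill, if_neg hv]
      rw [tsum_eq_sum (s := S) (fun z hz => by simp [hS z hz]), Finset.sum_mul]
      exact Finset.sum_congr rfl fun z _ => by ring
  have h2 : ∀ z, Summable (fun v => N.p z v * ψ v) := fun z =>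
    summable_of_ne_finset_zero (s := N.nb z) (fun v hv => by simp [N.p_zero hv])
  simp only [EE, h1]
  rw [Summable.tsum_finsetSum (fun z _ => (h2 z).mul_left _),
    tsum_eq_sum (s := S) (fun z hz => by simp [hS z hz])]
  refine Finset.sum_congr rfl fun z _ => ?_
  rw [tsum_mul_left, PP_tsum]

lemma EE_succ' (x : V) (n : ℕ) (y : V) (φ : V → ℝ) :
    N.EE {x} (n+1) y φ = N.EE {x} n y (N.PP φ) - N.EE {x} n y (fun z => N.p z x) * φ x := by
  rw [EE_succ]
  have : N.PP (kill {x} φ)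
    = fun v => N.PP φ v - N.p v x * φ x := funext (N.PP_kill x φ)
  rw [this, EE_sub, EE_mul]

/-- Survival probability. -/
noncomputable def mass (x : V) (n : ℕ) (y : V) : ℝ := N.EE {x} n y (fun _ => 1)

lemma mass_succ (x : V) (n : ℕ) (y : V) :
    N.mass x (n+1) y = N.mass x n y - N.EE {x} n y (fun z => N.p z x) := by
  have : N.PP (fun _ => (1:ℝ)) = fun _ => 1 := funext (N.PP_const 1)
  simp [mass, EE_succ', this]

lemma mass_nonneg (x : V) (n : ℕ) (y : V) : 0 ≤ N.mass x n y :=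
  N.EE_nonneg _ _ _ fun _ => zero_le_one

lemma mass_zero {x y : V} (h : y ≠ x) : N.mass x 0 y = 1 := N.EE_zero _ _ (by simpa using h) _

lemma sum_hit {x y : V} (h : y ≠ x) (n : ℕ) :
    ∑ k ∈ Finset.range n, N.EE {x} k y (fun z => N.p z x) = 1 - N.mass x n y := by
  induction n with
  | zero => simp [N.mass_zero h]
  | succ n ih => rw [Finset.sum_range_succ, ih, mass_succ]; ring

lemma mass_self (x : V) (n : ℕ) : N.mass x n x = 0 := by
  simp [mass, EE, N.avoid_start {x} (Set.mem_singleton x)]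

lemma mass_anti (x y : V) : Antitone (fun n => N.mass x n y) :=
  antitone_nat_of_succ_le fun n => by
    rw [mass_succ]
    linarith [N.EE_nonneg {x} n y (fun z => N.p_nonneg z x)]

lemma mass_le_one (x : V) (n : ℕ) (y : V) : N.mass x n y ≤ 1 := by
  by_cases h : y = x
  · subst h; simp [mass_self]
  · rw [← N.mass_zero h]; exact N.mass_anti x y (Nat.zero_le n)

lemma EE_iter (x : V) (n : ℕ) (y : V) (hy : y ≠ x) (φ : V → ℝ) :
    N.EE {x} n y φ
      = ((fun f : V → ℝ => N.PP (kill {x} f))^[n] φ) y := by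
  induction n generalizing φ with
  | zero => simpa using N.EE_zero _ _ (by simpa using hy) φ
  | succ n ih => rw [EE_succ, ih, Function.iterate_succ_apply]

lemma mass_back (x : V) (n : ℕ) (y : V) (hy : y ≠ x) :
    N.mass x (n+1) y = N.PP (N.mass x n) y := by
  rw [mass, EE_iter _ _ _ _ hy, Function.iterate_succ_apply']
  simp only [PP]
  refine Finset.sum_congr rfl fun z _ => ?_
  congr 1
  by_cases hz : z = x
  · subst hz; simp [mass_self, kill]
  · simp only [kill, Set.mem_singleton_iff, if_neg hz]
    rw [mass, EE_iter _ _ _ _ hz]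

lemma pstep_eq (n : ℕ) (x y : V) : N.pstep n x y = N.avoid ∅ n x y := by
  induction n generalizing y with
  | zero => simp [pstep, avoid]
  | succ n ih => simp [pstep, avoid, ih]

/-- Recurrence: the walk hits `x` almost surely. -/
lemma mass_tendsto (hrec : N.Recurrent) (x y : V) :
    Tendsto (fun n => N.mass x n y) atTop (𝓝 0) := by
  have hex : ∀ v, ∃ l, Tendsto (fun n => N.mass x n v) atTop (𝓝 l) := fun v =>
    ⟨_, tendsto_atTop_ciInf (N.mass_anti x v)
      ⟨0, by rintro _ ⟨n, rfl⟩; exact N.mass_nonneg x n v⟩⟩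
  choose q hq using hex
  have q0 : ∀ v, 0 ≤ q v := fun v => ge_of_tendsto' (hq v) fun n => N.mass_nonneg x n v
  have q1 : ∀ v, q v ≤ 1 := fun v => le_of_tendsto' (hq v) fun n => N.mass_le_one x n v
  have qx : q x = 0 := tendsto_nhds_unique (hq x) (by simp [mass_self])
  have qharm : ∀ v, v ≠ x → N.PP q v = q v := by
    intro v hv
    refine tendsto_nhds_unique (N.PP_tendsto hq v) ?_
    have := (tendsto_add_atTop_iff_nat 1).mpr (hq v)
    simpa only [N.mass_back x _ v hv] using this
  have hε0 : 0 ≤ N.PP q x := N.PP_nonneg q0 x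
  have hPq : N.PP q = fun v => q v + if v = x then N.PP q x else 0 := by
    funext v
    by_cases hv : v = x
    · subst hv; simp [qx]
    · simp [hv, qharm v hv]
  have hT : ∀ n, N.EE ∅ n x q = (∑ k ∈ Finset.range n, N.pstep k x x) * N.PP q x := by
    intro n
    induction n with
    | zero => simp [N.EE_zero ∅ x (by simp), qx]
    | succ n ih =>
      rw [EE_succ, kill_empty]
      have hstep : N.EE ∅ n x (N.PP q) = N.EE ∅ n x q + N.avoid ∅ n x x * N.PP q x := by
        conv_lhs => rw [hPq]
        rw [EE_add, EE_single]
      rw [hstep, ih, Finset.sum_range_succ, N.pstep_eq n]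
      ring
  have hone : ∀ n, N.EE ∅ n x (fun _ => (1:ℝ)) = 1 := by
    intro n
    induction n with
    | zero => simp [N.EE_zero ∅ x (by simp)]
    | succ n ih =>
      rw [EE_succ, kill_empty]
      rw [show N.PP (fun _ => (1:ℝ)) = fun _ => 1 from funext (N.PP_const 1), ih]
  have hε : N.PP q x = 0 := by
    by_contra hne
    have hpos : 0 < N.PP q x := lt_of_le_of_ne hε0 (Ne.symm hne)
    refine hrec x (summable_of_sum_range_le (c := 1 / N.PP q x) ?_ ?_)
    · intro n; rw [pstep_eq]; exact N.avoid_nonneg _ _ _ _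
    · intro n
      rw [le_div_iff₀ hpos, ← hT, ← hone n]
      exact N.EE_mono _ _ _ q1
  have hall : ∀ v, N.PP q v = q v := by
    intro v
    by_cases hv : v = x
    · subst hv; rw [hε, qx]
    · exact qharm v hv
  have key : q y = 0 := by
    have := N.conn x y
    induction this with
    | refl => exact qx
    | @tail a b _ hab ih =>
      have h1 : N.PP q a = 0 := by rw [hall, ih]
      have hb : b ∈ N.nb a := by simpa [nb] using hab
      have h2 := (Finset.sum_eq_zero_iff_of_nonneg
        (fun z _ => mul_nonneg (N.p_nonneg a z) (q0 z))).mp h1 b hb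
      exact (mul_eq_zero.mp h2).resolve_left (N.p_pos hab).ne'
  rw [← key]; exact hq y

lemma avoid_summable {x y : V} (hy : y ≠ x) (v : V) :
    Summable (fun n => N.avoid {x} n y v) := by
  have := N.conn v x
  induction this using Relation.ReflTransGen.head_induction_on with
  | refl => simpa [N.avoid_mem {x} y _ (Set.mem_singleton x)] using summable_zero
  | @head a b hab _ ih =>
    have hp := N.p_pos hab
    by_cases hb : b = x
    · subst hb
      refine summable_of_sum_range_le (c := 1 / N.p a b) (fun n => N.avoid_nonneg _ _ _ _) ?_
      intro n
      rw [le_div_iff₀ hp, Finset.sum_mul]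
      calc _ ≤ ∑ k ∈ Finset.range n, N.EE {b} k y (fun z => N.p z b) := by
            refine Finset.sum_le_sum fun k _ => ?_
            exact (N.EE_summable {b} k y (fun z => N.p z b)).le_tsum a
              (fun z _ => mul_nonneg (N.avoid_nonneg _ _ _ _) (N.p_nonneg _ _))
        _ ≤ 1 := by rw [N.sum_hit hy]; linarith [N.mass_nonneg b n y]
    · have h1 : Summable (fun n => N.avoid {x} (n+1) y b / N.p a b) :=
        ((summable_nat_add_iff 1).mpr ih).div_const _
      refine Summable.of_nonneg_of_le (fun n => N.avoid_nonneg _ _ _ _) (fun n => ?_) h1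
      rw [le_div_iff₀ hp, N.avoid_succ _ _ _ (by simpa using hb)]
      have ha : a ∈ N.nb b := by simpa [nb, N.symm b a] using hab
      exact Finset.single_le_sum (f := fun z => N.avoid {x} n y z * N.p z b)
        (fun z _ => mul_nonneg (N.avoid_nonneg _ _ _ _) (N.p_nonneg _ _)) ha

/-- Truncated Green density. -/
noncomputable def FN (x y : V) (n : ℕ) (v : V) : ℝ :=
  (∑ k ∈ Finset.range n, N.avoid {x} k y v) / N.cTot v

lemma FN_tendsto {x y : V} (hy : y ≠ x) (v : V) :
    Tendsto (fun n => N.FN x y n v) atTop (𝓝 (N.g x y v)) :=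
  ((N.avoid_summable hy v).hasSum.tendsto_sum_nat).div_const _

lemma FN_x (x y : V) (n : ℕ) : N.FN x y n x = 0 := by
  simp [FN, N.avoid_mem {x} y _ (Set.mem_singleton x)]

lemma PP_FN (x y : V) (n : ℕ) (v : V) :
    N.PP (N.FN x y n) v
      = (∑ k ∈ Finset.range n, ∑ z ∈ N.nb v, N.avoid {x} k y z * N.p z v) / N.cTot v := by
  rw [Finset.sum_comm, Finset.sum_div, PP]
  refine Finset.sum_congr rfl fun z _ => ?_
  rw [FN, ← Finset.sum_mul, mul_div_assoc, N.p_symm v z]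
  ring

lemma FN_succ {x y : V} (hy : y ≠ x) (n : ℕ) (v : V) (hv : v ≠ x) :
    N.FN x y (n+1) v = (if v = y then 1 / N.cTot y else 0) + N.PP (N.FN x y n) v := by
  rw [PP_FN, FN, Finset.sum_range_succ', add_div, add_comm]
  congr 1
  · by_cases h : v = y
    · subst h; simp [avoid, hv]
    · simp [avoid, h, Ne.symm h]
  · congr 1
    exact Finset.sum_congr rfl fun k _ => N.avoid_succ _ _ _ (by simpa using hv)

lemma PP_FN_x {x y : V} (hy : y ≠ x) (n : ℕ) :
    N.PP (N.FN x y n) x = (1 - N.mass x n y) / N.cTot x := by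
  rw [PP_FN, ← N.sum_hit hy]
  congr 1
  refine Finset.sum_congr rfl fun k _ => ?_
  exact (tsum_eq_sum (fun z hz => by simp [N.p_zero' hz])).symm

lemma g_eq {x y : V} (hy : y ≠ x) (v : V) (hv : v ≠ x) :
    N.g x y v = (if v = y then 1 / N.cTot y else 0) + N.PP (N.g x y) v := by
  refine tendsto_nhds_unique ((tendsto_add_atTop_iff_nat 1).mpr (N.FN_tendsto hy v)) ?_
  simp only [N.FN_succ hy _ v hv]
  exact (N.PP_tendsto (N.FN_tendsto hy) v).const_add _

lemma PP_g_x (hrec : N.Recurrent) {x y : V} (hy : y ≠ x) :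
    N.PP (N.g x y) x = 1 / N.cTot x := by
  refine tendsto_nhds_unique (N.PP_tendsto (N.FN_tendsto hy) x) ?_
  simp only [N.PP_FN_x hy]
  simpa using ((N.mass_tendsto hrec x y).const_sub 1).div_const (N.cTot x)

lemma g_x (x y : V) : N.g x y x = 0 := by
  simp [g, GreenK, N.avoid_mem {x} y _ (Set.mem_singleton x)]

lemma g_nonneg (x y v : V) : 0 ≤ N.g x y v :=
  div_nonneg (tsum_nonneg fun _ => N.avoid_nonneg _ _ _ _) (N.cTot_pos v).le

lemma g_min {x y : V} (hy : y ≠ x) (s : V → ℝ) (s0 : ∀ v, 0 ≤ s v)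
    (hs : ∀ v, v ≠ x → (if v = y then 1 / N.cTot y else 0) + N.PP s v ≤ s v) (v : V) :
    N.g x y v ≤ s v := by
  have h : ∀ n v, N.FN x y n v ≤ s v := by
    intro n
    induction n with
    | zero => intro v; simpa [FN] using s0 v
    | succ n ih =>
      intro v
      by_cases hv : v = x
      · subst hv; rw [FN_x]; exact s0 _
      · rw [N.FN_succ hy _ _ hv]
        linarith [hs v hv, N.PP_mono ih v]
  exact le_of_tendsto' (N.FN_tendsto hy v) fun n => h n v

lemma g_le {x y : V} (hy : y ≠ x) (v : V) : N.g x y v ≤ N.g x y y := by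
  refine (N.g_min hy (fun v => min (N.g x y v) (N.g x y y)) (fun v => ?_) ?_ v).trans
    (min_le_right _ _)
  · exact le_min (N.g_nonneg _ _ _) (N.g_nonneg _ _ _)
  · intro v hv
    have h1 := N.PP_mono (φ := fun v => min (N.g x y v) (N.g x y y)) (ψ := N.g x y)
      (fun z => min_le_left _ _) v
    have h2 := N.PP_mono (φ := fun v => min (N.g x y v) (N.g x y y)) (ψ := fun _ => N.g x y y)
      (fun z => min_le_right _ _) v
    rw [PP_const] at h2
    have h3 := N.g_eq hy v hv
    by_cases h : v = y
    · subst h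
      simp only [if_true, min_self] at *
      linarith
    · simp only [if_neg h, zero_add] at *
      exact le_min (h1.trans h3.ge) h2

lemma Reff_le (hrec : N.Recurrent) {x y : V} (hy : y ≠ x) : N.Reff y x ≤ N.Reff x y := by
  have h := N.g_min hy.symm (fun v => N.g x y y - N.g x y v)
    (fun v => sub_nonneg.mpr (N.g_le hy v)) ?_ x
  · simpa [Reff, g_x] using h
  · intro v hv
    rw [PP_sub, PP_const]
    by_cases h : v = x
    · subst h
      rw [N.PP_g_x hrec hy, g_x]; simp
    · have := N.g_eq hy v h
      rw [if_neg hv] at this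
      rw [if_neg h]; linarith

lemma one_side (hrec : N.Recurrent) (o : V) (h : V → ℝ) (hpot : N.IsPotential o h) {x y : V}
    (hy : y ≠ x) : h x - h y ≤ N.Reff x y := by
  obtain ⟨h0, _, ho, hl⟩ := hpot
  have hP : N.PP h = fun v => h v + if v = o then 1 / N.cTot o else 0 := by
    funext v
    rw [PP_lap]
    by_cases hv : v = o
    · subst hv; simp [ho]
    · simp [hv, hl v hv]
  have hE : ∀ n, N.EE {x} n y h = h y + N.FN x y n o - (1 - N.mass x n y) * h x := by
    intro n
    induction n with
    | zero => simp [N.EE_zero {x} y (by simpa using hy), FN, N.mass_zero hy]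
    | succ n ih =>
      rw [EE_succ', hP, EE_add, EE_single, ih, mass_succ, FN, FN, Finset.sum_range_succ]
      ring
  have h1 : ∀ n, 0 ≤ h y + N.FN x y n o - (1 - N.mass x n y) * h x := fun n => by
    rw [← hE]; exact N.EE_nonneg _ _ _ h0
  have h2 := ge_of_tendsto' (((N.FN_tendsto hy o).const_add (h y)).sub
    (((N.mass_tendsto hrec x y).const_sub 1).mul_const (h x))) h1
  have := N.g_le hy o
  rw [Reff]
  linarith

end Network

/-- Every potential on a recurrent rooted network is 1-Lipschitz with
respect to the effective resistance metric. -/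
theorem potential_reff_lipschitz {V : Type*} (N : Network V) (hrec : N.Recurrent)
    (o : V) (h : V → ℝ) (hpot : N.IsPotential o h) (x y : V) :
    |h x - h y| ≤ N.Reff x y := by
  by_cases hy : y = x
  · subst hy; simpa [Network.Reff] using N.g_nonneg y y y
  · refine abs_le.mpr ⟨?_, N.one_side hrec o h hpot hy⟩
    have h1 := N.one_side hrec o h hpot (Ne.symm hy)
    have h2 := N.Reff_le hrec hy
    linarith
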